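/- Let A, B ∈ ℂ^{m×n}. The matrix equation X = AXᴴB + C (unknown X ∈ ℂ^{m×n}) has a unique solution for every C ∈ ℂ^{m×n} if and only if η̄γ ≠ 1 for all eigenvalues η, γ of ABᴴ, where η̄ denotes the complex conjugate of η. -/

import Mathlib

open Matrix

/-- If `Y = M Y P` has a nonzero solution, it has one whose columns are eigenvectors of `M` for a
common eigenvalue. -/
theorem exists_eigen_of_eq_mul_mul {m : ℕ} {M P Y : Matrix (Fin m) (Fin m) ℂ}
    (hY : Y = M * Y * P) (hY0 : Y ≠ 0) :
    ∃ (μ : ℂ) (Z : Matrix (Fin m) (Fin m) ℂ), Z ≠ 0 ∧ M * Z = μ • Z ∧ Z = M * Z * P := by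
  let S : Submodule ℂ (Matrix (Fin m) (Fin m) ℂ) :=
    LinearMap.eqLocus LinearMap.id (LinearMap.mulRight ℂ P ∘ₗ LinearMap.mulLeft ℂ M)
  have mem_S (Z) : Z ∈ S ↔ Z = M * Z * P := Iff.rfl
  have hS : ∀ Z ∈ S, LinearMap.mulLeft ℂ M Z ∈ S := by
    intro Z hZ
    rw [mem_S] at hZ ⊢
    simp only [LinearMap.mulLeft_apply]
    conv_lhs => rw [hZ]
    simp only [Matrix.mul_assoc]
  have : Nontrivial S := ⟨⟨⟨Y, hY⟩, 0, fun h => hY0 (congrArg Subtype.val h)⟩⟩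
  obtain ⟨μ, hμ⟩ := Module.End.exists_eigenvalue ((LinearMap.mulLeft ℂ M).restrict hS)
  obtain ⟨Z, hZ⟩ := hμ.exists_hasEigenvector
  refine ⟨μ, Z, fun h => hZ.2 (Subtype.ext h), ?_, (mem_S _).1 Z.2⟩
  exact congrArg Subtype.val hZ.apply_eq_smul

theorem mem_spectrum_of_mul_eq_smul {m : ℕ} {M Z : Matrix (Fin m) (Fin m) ℂ} {μ : ℂ}
    (hZ0 : Z ≠ 0) (h : M * Z = μ • Z) : μ ∈ spectrum ℂ M := by
  rw [spectrum.mem_iff]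
  intro hu
  refine hZ0 (hu.mul_right_eq_zero.1 ?_)
  rw [sub_mul, h, Algebra.algebraMap_eq_smul_one, smul_mul_assoc, one_mul, sub_self]

theorem eq_zero_of_eq_mul_mul_conjTranspose {m : ℕ} {M Y : Matrix (Fin m) (Fin m) ℂ}
    (hM : ∀ η ∈ spectrum ℂ M, ∀ γ ∈ spectrum ℂ M, (starRingEnd ℂ) η * γ ≠ 1)
    (hY : Y = M * Y * Mᴴ) : Y = 0 := by
  by_contra hY0
  obtain ⟨μ, Z, hZ0, hμ, hZ⟩ := exists_eigen_of_eq_mul_mul hY hY0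
  rw [hμ, smul_mul_assoc] at hZ
  have hμ0 : μ ≠ 0 := by
    rintro rfl
    exact hZ0 (by rw [hZ, zero_smul])
  have hZ' : M * Zᴴ = (star μ)⁻¹ • Zᴴ := by
    have hstar := congrArg conjTranspose hZ
    rw [conjTranspose_smul, conjTranspose_mul, conjTranspose_conjTranspose] at hstar
    rw [eq_inv_smul_iff₀ (star_ne_zero.2 hμ0), ← hstar]
  refine hM _ (mem_spectrum_of_mul_eq_smul (by simpa using hZ0) hZ') _
    (mem_spectrum_of_mul_eq_smul hZ0 hμ) ?_
  simp [hμ0]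

theorem exists_mulVec_eq_smul_of_mem_spectrum {m : ℕ} {M : Matrix (Fin m) (Fin m) ℂ} {μ : ℂ}
    (h : μ ∈ spectrum ℂ M) : ∃ v ≠ 0, M *ᵥ v = μ • v := by
  rw [← Matrix.spectrum_toLin', ← Module.End.hasEigenvalue_iff_mem_spectrum] at h
  obtain ⟨v, hv⟩ := h.exists_hasEigenvector
  exact ⟨v, hv.2, by simpa using hv.apply_eq_smul⟩

theorem exists_eq_mul_mul_conjTranspose {m : ℕ} {M : Matrix (Fin m) (Fin m) ℂ} {η γ : ℂ}
    (hη : η ∈ spectrum ℂ M) (hγ : γ ∈ spectrum ℂ M) (h : (starRingEnd ℂ) η * γ = 1) :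
    ∃ Y ≠ 0, Y = M * Y * Mᴴ := by
  obtain ⟨w, hw0, hw⟩ := exists_mulVec_eq_smul_of_mem_spectrum hη
  obtain ⟨u, hu0, hu⟩ := exists_mulVec_eq_smul_of_mem_spectrum hγ
  refine ⟨vecMulVec u (star w), ?_, ?_⟩
  · simpa [vecMulVec_eq_zero] using ⟨hu0, hw0⟩
  · have hw' : star w ᵥ* Mᴴ = star η • star w := by
      rw [← star_mulVec, hw, star_smul]
    rw [mul_vecMulVec, vecMulVec_mul, hu, hw', smul_vecMulVec, vecMulVec_smul, smul_smul,
      mul_comm γ]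
    exact (by rw [show star η * γ = 1 from h, one_smul])

/-- The conjugate-linear map `X ↦ A Xᴴ B`, regarded as a real-linear map. -/
def mulConjTransposeMul {m n : ℕ} (A B : Matrix (Fin m) (Fin n) ℂ) :
    Matrix (Fin m) (Fin n) ℂ →ₗ[ℝ] Matrix (Fin m) (Fin n) ℂ where
  toFun X := A * Xᴴ * B
  map_add' X Y := by simp [Matrix.mul_add, Matrix.add_mul]
  map_smul' r X := by simp [conjTranspose_smul]

theorem existsUnique_iff_forall_fixed_eq_zero {m n : ℕ} (A B : Matrix (Fin m) (Fin n) ℂ) :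
    (∀ C : Matrix (Fin m) (Fin n) ℂ,
        ∃! X : Matrix (Fin m) (Fin n) ℂ, X = A * Xᴴ * B + C) ↔
      ∀ X : Matrix (Fin m) (Fin n) ℂ, X = A * Xᴴ * B → X = 0 := by
  constructor
  · intro h X hX
    exact (h 0).unique (by simpa using hX) (by simp)
  · intro h
    let L := LinearMap.id - mulConjTransposeMul A B
    have L_apply (X) : L X = X - A * Xᴴ * B := rfl
    have hinj : Function.Injective L := by
      rw [injective_iff_map_eq_zero]
      exact fun X hX => h X (sub_eq_zero.1 hX)
    intro C
    have := (Function.bijective_iff_existsUnique L).1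
      ⟨hinj, LinearMap.injective_iff_surjective.1 hinj⟩ C
    simpa only [L_apply, sub_eq_iff_eq_add'] using this

/-- A nonzero fixed point of the square of `X ↦ A Xᴴ B` yields one of the map itself. -/
theorem eq_zero_of_eq_sq {m n : ℕ} {A B X : Matrix (Fin m) (Fin n) ℂ}
    (h : ∀ X : Matrix (Fin m) (Fin n) ℂ, X = A * Xᴴ * B → X = 0)
    (hX : X = A * (A * Xᴴ * B)ᴴ * B) : X = 0 := by
  have hneg : X + A * Xᴴ * B = 0 := by
    apply h
    rw [conjTranspose_add, Matrix.mul_add, Matrix.add_mul, ← hX, add_comm]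
  have hI : Complex.I • X = 0 := by
    apply h
    rw [conjTranspose_smul, Matrix.mul_smul, Matrix.smul_mul,
      eq_neg_of_add_eq_zero_right hneg]
    simp
  exact (smul_eq_zero.1 hI).resolve_left Complex.I_ne_zero

/-- `X = AXᴴB + C` has a unique solution for every `C` iff
`η̄γ ≠ 1` for all eigenvalues `η, γ` of `ABᴴ`. -/
theorem eq_AXHB_unique_iff {m n : ℕ} (A B : Matrix (Fin m) (Fin n) ℂ) :
    (∀ C : Matrix (Fin m) (Fin n) ℂ,
        ∃! X : Matrix (Fin m) (Fin n) ℂ, X = A * Xᴴ * B + C) ↔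
      ∀ η ∈ spectrum ℂ (A * Bᴴ), ∀ γ ∈ spectrum ℂ (A * Bᴴ),
        (starRingEnd ℂ) η * γ ≠ 1 := by
  rw [existsUnique_iff_forall_fixed_eq_zero]
  have sq (X : Matrix (Fin m) (Fin n) ℂ) :
      A * (A * Xᴴ * B)ᴴ * B = A * Bᴴ * (X * Aᴴ) * B := by
    simp only [conjTranspose_mul, conjTranspose_conjTranspose, Matrix.mul_assoc]
  have hM : (A * Bᴴ)ᴴ = B * Aᴴ := by simp
  constructor
  · intro h η hη γ hγ hηγ
    obtain ⟨Y, hY0, hY⟩ := exists_eq_mul_mul_conjTranspose hη hγ hηγ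
    have hYA : A * Bᴴ * Y * B * Aᴴ = Y := by
      conv_rhs => rw [hY, hM, ← Matrix.mul_assoc]
    have hX : A * Bᴴ * Y * B = 0 := eq_zero_of_eq_sq h (by rw [sq, hYA])
    exact hY0 (by rw [← hYA, hX, Matrix.zero_mul])
  · intro h X hX
    have hX2 : X = A * Bᴴ * (X * Aᴴ) * B := by rw [← sq, ← hX, ← hX]
    have hY : X * Aᴴ = 0 := by
      apply eq_zero_of_eq_mul_mul_conjTranspose h
      rw [hM, ← Matrix.mul_assoc _ B, ← hX2]
    rw [hX2, hY, Matrix.mul_zero, Matrix.zero_mul]
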